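/- Let n ≥ 1, let L : ℝⁿ × ℝⁿ → ℝ be C¹, and suppose there exist c₀ > 0 and c₁ ∈ ℝ such that E(q,v) ≥ c₀·L(q,v) − c₁ for all (q,v) ∈ ℝⁿ × ℝⁿ. Then for every k ∈ ℝ, every C¹ curve x : [0,1] → ℝⁿ and every T > 0 one has A_k(x,T) ≤ (T/c₀)·[(c₀+1)k + c₁ − ∂A_k/∂T(x,T)], where ∂A_k/∂T(x,T) denotes the derivative of T ↦ A_k(x,T). -/

import Mathlib

open MeasureTheory

/-- The energy associated with a Lagrangian `L` in local coordinates: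
`E(q,v) = ∂_v L(q,v)[v] - L(q,v)`. -/
noncomputable def energy {n : ℕ} (L : EuclideanSpace ℝ (Fin n) × EuclideanSpace ℝ (Fin n) → ℝ)
    (q v : EuclideanSpace ℝ (Fin n)) : ℝ :=
  fderiv ℝ (fun w => L (q, w)) v v - L (q, v)

/-- The free-time action `A_k(x,T) = T ∫₀¹ [L(x(s), x'(s)/T) + k] ds`. -/
noncomputable def freeTimeAction {n : ℕ} (L : EuclideanSpace ℝ (Fin n) × EuclideanSpace ℝ (Fin n) → ℝ)
    (k : ℝ) (x : ℝ → EuclideanSpace ℝ (Fin n)) (T : ℝ) : ℝ :=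
  T * ∫ s in (0:ℝ)..1, (L (x s, T⁻¹ • deriv x s) + k)

/-- Differentiation under an interval integral when the derivative of the integrand is jointly
continuous. -/
theorem hasDerivAt_intervalIntegral_of_continuous {F F' : ℝ → ℝ → ℝ} {a b : ℝ}
    (hF : ∀ u, Continuous (F u)) (hF' : Continuous (Function.uncurry F'))
    (hd : ∀ u s, HasDerivAt (fun u => F u s) (F' u s) u) (u₀ : ℝ) :
    HasDerivAt (fun u => ∫ s in a..b, F u s) (∫ s in a..b, F' u₀ s) u₀ := by
  obtain ⟨C, hC⟩ := ((isCompact_closedBall u₀ 1).prod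
    (isCompact_uIcc (a := a) (b := b))).exists_bound_of_continuousOn hF'.continuousOn
  refine (intervalIntegral.hasDerivAt_integral_of_dominated_loc_of_deriv_le
    (bound := fun _ => C) (Metric.ball_mem_nhds u₀ one_pos)
    (Filter.Eventually.of_forall fun u => (hF u).aestronglyMeasurable)
    ((hF u₀).intervalIntegrable a b)
    (hF'.comp (Continuous.prodMk_right u₀)).aestronglyMeasurable
    (Filter.Eventually.of_forall fun s hs u hu => ?_) intervalIntegrable_const
    (Filter.Eventually.of_forall fun s _ u _ => hd u s)).2
  exact hC (u, s) ⟨Metric.ball_subset_closedBall hu, Set.uIoc_subset_uIcc hs⟩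

/-- For differentiable `L`, the energy in terms of the full derivative of `L`. -/
theorem energy_eq_fderiv {n : ℕ}
    {L : EuclideanSpace ℝ (Fin n) × EuclideanSpace ℝ (Fin n) → ℝ} (hL : Differentiable ℝ L)
    (q v : EuclideanSpace ℝ (Fin n)) :
    energy L q v = fderiv ℝ L (q, v) (0, v) - L (q, v) := by
  have h : fderiv ℝ (fun w => L (q, w)) v = _ :=
    ((hL (q, v)).hasFDerivAt.comp v (hasFDerivAt_prodMk_right q v)).fderiv
  simp [energy, h]

/-- The derivative of the free-time action in `T` is the average of `k - E` along the curve. -/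
theorem hasDerivAt_freeTimeAction {n : ℕ}
    {L : EuclideanSpace ℝ (Fin n) × EuclideanSpace ℝ (Fin n) → ℝ} (hL : ContDiff ℝ 1 L)
    (k : ℝ) {x : ℝ → EuclideanSpace ℝ (Fin n)} (hx : ContDiff ℝ 1 x) {T : ℝ} (hT : T ≠ 0) :
    HasDerivAt (fun T' => freeTimeAction L k x T')
      (∫ s in (0:ℝ)..1, (k - energy L (x s) (T⁻¹ • deriv x s))) T := by
  have hLc := hL.continuous
  have hxc := hx.continuous
  have hx' : Continuous (deriv x) := hx.continuous_deriv le_rfl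
  have hL' : Continuous (fderiv ℝ L) := hL.continuous_fderiv one_ne_zero
  have hLd : Differentiable ℝ L := hL.differentiable one_ne_zero
  have hcont (u : ℝ) : Continuous fun s => L (x s, u • deriv x s) + k := by fun_prop
  have hcont' : Continuous (Function.uncurry fun u s : ℝ =>
      fderiv ℝ L (x s, u • deriv x s) (0, deriv x s)) := by
    unfold Function.uncurry
    fun_prop
  have hG := hasDerivAt_intervalIntegral_of_continuous (a := 0) (b := 1) hcont hcont'
    (fun u s => ((hLd _).hasFDerivAt.comp_hasDerivAt u
      ((hasDerivAt_const u (x s)).prodMk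
        (by simpa using (hasDerivAt_id u).smul_const (deriv x s)))).add_const k) T⁻¹
  have hA := (hasDerivAt_id T).mul (hG.comp T (hasDerivAt_inv hT))
  have henergy (s : ℝ) : k - energy L (x s) (T⁻¹ • deriv x s) =
      (L (x s, T⁻¹ • deriv x s) + k) -
        T⁻¹ * fderiv ℝ L (x s, T⁻¹ • deriv x s) (0, deriv x s) := by
    have h : ((0, T⁻¹ • deriv x s) : EuclideanSpace ℝ (Fin n) × EuclideanSpace ℝ (Fin n)) =
        T⁻¹ • (0, deriv x s) := by simp
    rw [energy_eq_fderiv hLd, h, map_smul, smul_eq_mul]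
    ring
  have hFT : Continuous fun s => fderiv ℝ L (x s, T⁻¹ • deriv x s) (0, deriv x s) := by fun_prop
  refine hA.congr_deriv ?_
  simp only [henergy]
  rw [intervalIntegral.integral_sub ((hcont _).intervalIntegrable _ _)
    ((hFT.intervalIntegrable _ _).const_mul T⁻¹),
    intervalIntegral.integral_const_mul]
  simp only [id, Function.comp_apply]
  field_simp
  ring

/-- If `E(q,v) ≥ c₀·L(q,v) - c₁` then
`A_k(x,T) ≤ (T/c₀)·[(c₀+1)k + c₁ - ∂A_k/∂T(x,T)]`. -/
theorem freeTimeAction_upper_bound_by_T_derivative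
    (n : ℕ) (hn : 1 ≤ n)
    (L : EuclideanSpace ℝ (Fin n) × EuclideanSpace ℝ (Fin n) → ℝ) (hL : ContDiff ℝ 1 L)
    (c₀ : ℝ) (hc₀ : 0 < c₀) (c₁ : ℝ)
    (hEL : ∀ q v : EuclideanSpace ℝ (Fin n), c₀ * L (q, v) - c₁ ≤ energy L q v)
    (k : ℝ) (x : ℝ → EuclideanSpace ℝ (Fin n)) (hx : ContDiff ℝ 1 x) (T : ℝ) (hT : 0 < T) :
    freeTimeAction L k x T
      ≤ (T / c₀) * ((c₀ + 1) * k + c₁ - deriv (fun T' => freeTimeAction L k x T') T) := by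
  have hLc := hL.continuous
  have hxc := hx.continuous
  have hx' : Continuous (deriv x) := hx.continuous_deriv le_rfl
  have hL' : Continuous (fderiv ℝ L) := hL.continuous_fderiv one_ne_zero
  have hE : Continuous fun s => energy L (x s) (T⁻¹ • deriv x s) := by
    simp only [energy_eq_fderiv (hL.differentiable one_ne_zero)]
    fun_prop
  have hLs : Continuous fun s => L (x s, T⁻¹ • deriv x s) + k := by fun_prop
  have hmono : ∫ s in (0:ℝ)..1, (k - energy L (x s) (T⁻¹ • deriv x s)) ≤
      ∫ s in (0:ℝ)..1, (((c₀ + 1) * k + c₁) - c₀ * (L (x s, T⁻¹ • deriv x s) + k)) := by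
    refine intervalIntegral.integral_mono_on zero_le_one
      ((continuous_const.sub hE).intervalIntegrable _ _)
      ((continuous_const.sub (hLs.const_smul c₀)).intervalIntegrable _ _) fun s _ => ?_
    linarith [hEL (x s) (T⁻¹ • deriv x s)]
  rw [intervalIntegral.integral_sub intervalIntegrable_const
    ((hLs.intervalIntegrable _ _).const_mul c₀), intervalIntegral.integral_const_mul,
    intervalIntegral.integral_const] at hmono
  rw [(hasDerivAt_freeTimeAction hL k hx hT.ne').deriv, freeTimeAction, div_mul_eq_mul_div,
    le_div_iff₀ hc₀, mul_assoc]
  refine mul_le_mul_of_nonneg_left ?_ hT.le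
  simp only [sub_zero, one_smul] at hmono
  linarith
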